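/- arXiv:2306.17401 — 2 statements merged into one kernel-verified Lean document; each statement's English description precedes it below -/
import Mathlib

section
/- For every integer n ≥ 3, the minimum over k ∈ {1, 2, …, n−1} of the rational number R_k / L_k equals (⌈n/2⌉ − 1) / ⌈n/2⌉. (Note that L_k = 2*C(n−2, k−1) > 0 for 1 ≤ k ≤ n−1, so the ratios are well defined.) -/
/-- Binomial coefficient `C(a, b)` for integer lower index, with `C(a,b) = 0` for `b < 0`. -/
def C (a : ℕ) (b : ℤ) : ℕ := if b < 0 then 0 else a.choose b.toNat

/-- `R_k = C(n−2, k−2) + C(n−2, k)`. -/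
def R (n k : ℕ) : ℕ := C (n - 2) ((k : ℤ) - 2) + C (n - 2) (k : ℤ)

/-- `L_k = 2·C(n−2, k−1)`. -/
def L (n k : ℕ) : ℕ := 2 * C (n - 2) ((k : ℤ) - 1)

theorem R_div_L_add_add (j l : ℕ) :
    (R (j + l + 2) (j + 1) : ℚ) / (L (j + l + 2) (j + 1) : ℚ)
      = ((j + l + 2) * (j + l + 1)) / (2 * ((j + 1) * (l + 1))) - 1 := by
  have hL : L (j + l + 2) (j + 1) = 2 * (j + l).choose j := by
    simp [L, C]
  have hpos : (0 : ℚ) < (j + l).choose j := by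
    exact_mod_cast Nat.choose_pos (Nat.le_add_right j l)
  have hlower : (C (j + l) (((j + 1 : ℕ) : ℤ) - 2) : ℚ) * (l + 1) = (j + l).choose j * j := by
    cases j with
    | zero => simp [C]
    | succ i =>
      have e : C (i + 1 + l) (((i + 1 + 1 : ℕ) : ℤ) - 2) = (i + 1 + l).choose i := by
        have : (((i + 1 + 1 : ℕ) : ℤ) - 2) = (i : ℤ) := by push_cast; ring
        rw [this]
        simp [C]
      have h := Nat.choose_succ_right_eq (i + 1 + l) i
      rw [show i + 1 + l - i = l + 1 by omega] at h
      rw [e]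
      exact_mod_cast h.symm
  have hupper : (C (j + l) ((j + 1 : ℕ) : ℤ) : ℚ) * (j + 1) = (j + l).choose j * l := by
    have e : C (j + l) ((j + 1 : ℕ) : ℤ) = (j + l).choose (j + 1) := by
      simp only [C, Int.toNat_natCast]
      exact if_neg (by omega)
    have h := Nat.choose_succ_right_eq (j + l) j
    rw [Nat.add_sub_cancel_left] at h
    rw [e]
    exact_mod_cast h
  have hj : (0 : ℚ) < j + 1 := by positivity
  have hl : (0 : ℚ) < l + 1 := by positivity
  rw [hL, R, Nat.add_sub_cancel]
  push_cast at hlower hupper ⊢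
  rw [← eq_div_iff hl.ne'] at hlower
  rw [← eq_div_iff hj.ne'] at hupper
  rw [hlower, hupper]
  field_simp
  ring

theorem R_div_L {n k : ℕ} (hk : 1 ≤ k) (hkn : k < n) :
    (R n k : ℚ) / (L n k : ℚ) = (n * (n - 1)) / (2 * (k * (n - k))) - 1 := by
  obtain ⟨j, rfl⟩ := Nat.exists_eq_add_of_le' hk
  obtain ⟨l, rfl⟩ : ∃ l, n = j + l + 2 := ⟨n - j - 2, by omega⟩
  rw [R_div_L_add_add]
  push_cast
  ring_nf

theorem ceil_natCast_div_two (n : ℕ) : ⌈(n : ℚ) / 2⌉ = ((n - n / 2 : ℕ) : ℤ) := by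
  have h₁ : n ≤ 2 * (n - n / 2) := by omega
  have h₂ : 2 * (n - n / 2) < n + 2 := by omega
  rw [Int.ceil_eq_iff]
  generalize n - n / 2 = t at *
  have h₁' : (n : ℚ) ≤ 2 * t := by exact_mod_cast h₁
  have h₂' : (2 : ℚ) * t < n + 2 := by exact_mod_cast h₂
  push_cast
  constructor <;> linarith

theorem mul_sub_le_half_mul_sub_half (n k : ℕ) :
    (k : ℚ) * (n - k) ≤ (n / 2 : ℕ) * (n - (n / 2 : ℕ)) := by
  have h₁ : 2 * (n / 2) ≤ n := by omega
  have h₂ : n ≤ 2 * (n / 2) + 1 := by omega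
  generalize n / 2 = s at *
  have key : (k : ℤ) * (n - k) ≤ s * (n - s) := by
    rcases le_or_gt k s with h | h
    · zify at *
      nlinarith
    · have h' : s + 1 ≤ k := h
      zify at *
      nlinarith
  exact_mod_cast key

theorem R_div_L_half {n : ℕ} (hn : 3 ≤ n) :
    (R n (n / 2) : ℚ) / (L n (n / 2) : ℚ)
      = ((⌈(n : ℚ) / 2⌉ : ℚ) - 1) / (⌈(n : ℚ) / 2⌉ : ℚ) := by
  rw [R_div_L (by omega) (by omega), ceil_natCast_div_two, Int.cast_natCast]
  have hs : 0 < n / 2 := by omega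
  have hsum : n = n / 2 + (n - n / 2) := by omega
  have hcases : n - n / 2 = n / 2 ∨ n - n / 2 = n / 2 + 1 := by omega
  generalize n / 2 = s at *
  generalize n - s = t at *
  have hs' : (0 : ℚ) < s := by exact_mod_cast hs
  subst hsum
  push_cast
  rw [add_sub_cancel_left]
  rcases hcases with rfl | rfl
  · field_simp
    ring
  · push_cast
    field_simp
    ring

theorem stmt_4 (n : ℕ) (hn : 3 ≤ n) :
    (Finset.Icc 1 (n - 1)).inf' (Finset.nonempty_Icc.mpr (by omega))
        (fun k => (R n k : ℚ) / (L n k : ℚ))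
      = ((⌈(n : ℚ) / 2⌉ : ℚ) - 1) / (⌈(n : ℚ) / 2⌉ : ℚ) := by
  rw [← R_div_L_half hn]
  apply le_antisymm
  · exact Finset.inf'_le (fun k => (R n k : ℚ) / (L n k : ℚ))
      (Finset.mem_Icc.mpr ⟨by omega, by omega⟩)
  · refine Finset.le_inf' _ _ fun k hk => ?_
    obtain ⟨hk₁, hk₂⟩ := Finset.mem_Icc.mp hk
    have hkn : k < n := by omega
    rw [R_div_L hk₁ hkn, R_div_L (by omega) (by omega)]
    have hk₀ : (0 : ℚ) < k := by exact_mod_cast hk₁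
    have hnk : (0 : ℚ) < n - k := sub_pos.mpr (by exact_mod_cast hkn)
    have hn₁ : (0 : ℚ) ≤ n - 1 := sub_nonneg.mpr (by exact_mod_cast (by omega : 1 ≤ n))
    have := mul_sub_le_half_mul_sub_half n k
    gcongr
end

section
/- Let n ≥ 2 be a natural number and define P_e : ℝ → ℝ by P_e(x) = 1 − (1/n) * (Real.sqrt(1 − (n−1)*(1−x)/n) + (n−1) * Real.sqrt((1−x)/n))^2. Then P_e is strictly monotone increasing on the interval [0, 1]. -/
/-- On the ellipse `a ^ 2 + m * b ^ 2 = 1`, the linear form `a + m * b` increases strictly with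
`b` as long as `0 ≤ b ≤ a`. -/
theorem add_mul_lt_add_mul_of_ellipse {m a₁ a₂ b₁ b₂ : ℝ} (hm : 0 < m) (ha₁ : 0 ≤ a₁)
    (hb : b₁ < b₂) (hb₁ : 0 ≤ b₁) (hba₂ : b₂ ≤ a₂)
    (h₁ : a₁ ^ 2 + m * b₁ ^ 2 = 1) (h₂ : a₂ ^ 2 + m * b₂ ^ 2 = 1) :
    a₁ + m * b₁ < a₂ + m * b₂ := by
  have hmb : 0 < m * (b₂ - b₁) := mul_pos hm (sub_pos.2 hb)
  have ha : a₂ < a₁ := by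
    refine lt_of_pow_lt_pow_left₀ 2 ha₁ ?_
    nlinarith
  by_contra! h
  have h_sum : b₁ + b₂ < a₁ + a₂ := by linarith
  nlinarith [mul_lt_mul_of_pos_left h_sum hmb,
    mul_le_mul_of_nonneg_right (show m * (b₂ - b₁) ≤ a₁ - a₂ by linarith)
      (show 0 ≤ a₁ + a₂ by linarith)]

theorem stmt_10 (n : ℕ) (hn : 2 ≤ n) :
    StrictMonoOn
      (fun x : ℝ => 1 - (1 / (n : ℝ)) *
        (Real.sqrt (1 - ((n : ℝ) - 1) * (1 - x) / n) +
          ((n : ℝ) - 1) * Real.sqrt ((1 - x) / n)) ^ 2)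
      (Set.Icc 0 1) := by
  rintro x ⟨hx, -⟩ y ⟨hy, hy1⟩ hxy
  have hn' : (2 : ℝ) ≤ n := by exact_mod_cast hn
  have hn0 : (0 : ℝ) < n := by linarith
  have hm : (0 : ℝ) < n - 1 := by linarith
  have h_le (z : ℝ) (hz : 0 ≤ z) : (1 - z) / n ≤ 1 - ((n : ℝ) - 1) * (1 - z) / n := by
    rw [← sub_nonneg]
    have : 1 - ((n : ℝ) - 1) * (1 - z) / n - (1 - z) / n = z := by field_simp; ring
    rwa [this]
  have h_ellipse (z : ℝ) (hz : 0 ≤ z) (hz1 : z ≤ 1) :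
      √(1 - ((n : ℝ) - 1) * (1 - z) / n) ^ 2 + (n - 1) * √((1 - z) / n) ^ 2 = 1 := by
    have h0 : 0 ≤ (1 - z) / n := div_nonneg (by linarith) hn0.le
    rw [Real.sq_sqrt (h0.trans (h_le z hz)), Real.sq_sqrt h0]
    ring
  have h_lt := add_mul_lt_add_mul_of_ellipse hm (Real.sqrt_nonneg _)
    (Real.sqrt_lt_sqrt (div_nonneg (by linarith) hn0.le)
      (div_lt_div_of_pos_right (show 1 - y < 1 - x by linarith) hn0))
    (Real.sqrt_nonneg _) (Real.sqrt_le_sqrt (h_le x hx))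
    (h_ellipse y hy hy1) (h_ellipse x hx (by linarith))
  refine sub_lt_sub_left (mul_lt_mul_of_pos_left ?_ (one_div_pos.2 hn0)) 1
  exact pow_lt_pow_left₀ h_lt (by positivity) two_ne_zero
end
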